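/- For every δ ∈ (−1,1), the map Ψ_δ is a continuous bijection from [0,1]² onto [0,1]², and Ψ_δ(x) = x for every x ∈ ∂[0,1]². -/

import Mathlib

open MeasureTheory Set Filter

noncomputable section

/-- The closed unit square `[0,1]²` in the plane `ℝ × ℝ`. -/
def unitSq : Set (ℝ × ℝ) := Set.Icc (0:ℝ) 1 ×ˢ Set.Icc (0:ℝ) 1

/-- The topological boundary of the unit square. -/
def unitSqBdry : Set (ℝ × ℝ) :=
  {x ∈ unitSq | x.1 = 0 ∨ x.1 = 1 ∨ x.2 = 0 ∨ x.2 = 1}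

/-- The domain `[0,1] × [0,1/2) \ {(1/2,0)}` of the parametrisation `K`. -/
def lowerDom : Set (ℝ × ℝ) :=
  (Set.Icc (0:ℝ) 1 ×ˢ Set.Ico (0:ℝ) (1/2)) \ {((1/2 : ℝ), (0 : ℝ))}

/-- The hypotheses on the auxiliary function `h : [0,1/2) → [0,∞)`. -/
def GoodH (h : ℝ → ℝ) : Prop :=
  (∀ r ∈ Set.Ico (0:ℝ) (1/2), 0 ≤ h r) ∧
  MonotoneOn h (Set.Ico (0:ℝ) (1/2)) ∧
  (∀ r ∈ Set.Icc (0:ℝ) (1/10), h r = 0) ∧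
  Filter.Tendsto h (nhdsWithin (1/2 : ℝ) (Set.Iio (1/2 : ℝ))) Filter.atTop ∧
  ContDiffOn ℝ 3 h (Set.Ico (0:ℝ) (1/2)) ∧
  ∃ c : ℝ, ∀ r ∈ Set.Ico (0:ℝ) (1/2),
    (deriv h r) ^ 2 ≤ c * (r + h r) ^ 3 ∧
    deriv (deriv h) r * deriv h r ≤ c * (r + h r) ^ 3 ∧
    |deriv (deriv (deriv h)) r| ≤ c * (r + h r) ^ 2

/-- The defining property of the angle function `Θ`. -/
def GoodTheta (h : ℝ → ℝ) (r₀ : ℝ) (Θ : ℝ → ℝ) : Prop :=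
  (∀ r : ℝ, 0 < r → r ≤ r₀ → Θ r = Real.arccos (h r / (h r + r))) ∧
  (∀ r : ℝ, r₀ < r → r < 1/2 → Θ r = Real.arcsin (1 / (2 * (h r + r))))

/-- The defining property of the `r-θ` parametrisation `K`. -/
def GoodK (h Θ : ℝ → ℝ) (K : ℝ × ℝ → ℝ × ℝ) : Prop :=
  Set.BijOn K lowerDom (Set.Ioo (0:ℝ) (1/2) ×ˢ Set.Icc (-1:ℝ) 1) ∧
  ∀ x ∈ lowerDom,
    x.1 = 1/2 + ((K x).1 + h (K x).1) * Real.sin ((K x).2 * Θ (K x).1) ∧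
    x.2 = ((K x).1 + h (K x).1) * Real.cos ((K x).2 * Θ (K x).1) - h (K x).1

/-- The weight function `w_r(θ) = 1 + h'(r) − h'(r) cos(θ Θ(r))`. -/
def wgt (h Θ : ℝ → ℝ) (r θ : ℝ) : ℝ :=
  1 + deriv h r - deriv h r * Real.cos (θ * Θ r)

/-- The defining properties of the family of stretching bijections `g_r`. -/
def IsGFamily (h Θ : ℝ → ℝ) (δ : ℝ) (g : ℝ → ℝ → ℝ) : Prop :=
  ∀ r ∈ Set.Ioo (0:ℝ) (1/2),
    StrictMonoOn (g r) (Set.Icc (-1:ℝ) 1) ∧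
    Set.BijOn (g r) (Set.Icc (-1:ℝ) 1) (Set.Icc (-1:ℝ) 1) ∧
    g r (-1) = -1 ∧ g r 1 = 1 ∧
    (∀ ℓ ∈ Set.Icc (-1:ℝ) 0,
      (1 + δ) * ∫ θ in (-1:ℝ)..ℓ, wgt h Θ r θ = ∫ θ in (-1:ℝ)..(g r ℓ), wgt h Θ r θ) ∧
    (∀ ℓ ∈ Set.Icc (0:ℝ) 1,
      (1 - δ) * ∫ θ in ℓ..(1:ℝ), wgt h Θ r θ = ∫ θ in (g r ℓ)..(1:ℝ), wgt h Θ r θ)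

/-- The defining properties of the map `Ψ_δ` in terms of `K` and the family `g`. -/
def IsPsi (K : ℝ × ℝ → ℝ × ℝ) (δ : ℝ) (g : ℝ → ℝ → ℝ) (Ψ : ℝ × ℝ → ℝ × ℝ) : Prop :=
  (∀ x ∈ lowerDom, Ψ x ∈ lowerDom ∧ (K (Ψ x)).1 = (K x).1 ∧
      (K (Ψ x)).2 = g (K x).1 (K x).2) ∧
  Ψ (1/2, 0) = (1/2, 0) ∧
  (∀ x ∈ unitSq, 1/2 < x.2 → Ψ x = ((Ψ (x.1, 1 - x.2)).1, 1 - (Ψ (x.1, 1 - x.2)).2)) ∧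
  (∀ x₁ : ℝ, 0 ≤ x₁ → x₁ ≤ 1/2 → Ψ (x₁, 1/2) = ((1 + δ) * x₁, 1/2)) ∧
  (∀ x₁ : ℝ, 1/2 ≤ x₁ → x₁ ≤ 1 → Ψ (x₁, 1/2) = ((1 + δ)/2 + (1 - δ) * (x₁ - 1/2), 1/2))


/-! ### Elementary facts about `h` and `Θ` -/

lemma goodH_nonneg {h : ℝ → ℝ} (hh : GoodH h) {r : ℝ} (hr : r ∈ Ioo (0:ℝ) (1/2)) : 0 ≤ h r :=
  hh.1 r ⟨hr.1.le, hr.2⟩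

lemma goodH_contDiffOn {h : ℝ → ℝ} (hh : GoodH h) : ContDiffOn ℝ 3 h (Ioo (0:ℝ) (1/2)) :=
  hh.2.2.2.2.1.mono Ioo_subset_Ico_self

lemma goodH_continuousOn {h : ℝ → ℝ} (hh : GoodH h) : ContinuousOn h (Ioo (0:ℝ) (1/2)) :=
  (goodH_contDiffOn hh).continuousOn

lemma goodH_continuousOn_deriv {h : ℝ → ℝ} (hh : GoodH h) :
    ContinuousOn (deriv h) (Ioo (0:ℝ) (1/2)) :=
  (goodH_contDiffOn hh).continuousOn_deriv_of_isOpen isOpen_Ioo (by norm_num)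

lemma goodH_deriv_nonneg {h : ℝ → ℝ} (hh : GoodH h) {r : ℝ} (hr : r ∈ Ioo (0:ℝ) (1/2)) :
    0 ≤ deriv h r := by
  rw [← derivWithin_of_isOpen isOpen_Ioo hr]
  exact (hh.2.1.mono Ioo_subset_Ico_self).derivWithin_nonneg

lemma theta_formula {h : ℝ → ℝ} (hh : GoodH h)
    {r₀ : ℝ} (hr₀ : r₀ ∈ Ioo (0:ℝ) (1/2)) (hr₀eq : 2 * r₀ * h r₀ + r₀ ^ 2 = 1/4)
    {Θ : ℝ → ℝ} (hΘ : GoodTheta h r₀ Θ) {r : ℝ} (hr : r ∈ Ioo (0:ℝ) (1/2)) :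
    Θ r = Real.arcsin (min (√(r ^ 2 + 2 * r * h r)) (1/2) / (r + h r)) ∧
    (r₀ < r → min (√(r ^ 2 + 2 * r * h r)) (1/2) = 1/2) := by
  have h0 := goodH_nonneg hh hr
  have h00 := goodH_nonneg hh hr₀
  have hpos : 0 < r + h r := by linarith [hr.1]
  have hsq : √(1/4 : ℝ) = 1/2 := by
    rw [show (1/4:ℝ) = (1/2)^2 by norm_num]; exact Real.sqrt_sq (by norm_num)
  rcases le_or_gt r r₀ with hle | hlt
  · refine ⟨?_, fun hc => absurd hc (not_lt.2 hle)⟩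
    have hm : h r ≤ h r₀ := hh.2.1 ⟨hr.1.le, hr.2⟩ ⟨hr₀.1.le, hr₀.2⟩ hle
    have hq : r ^ 2 + 2 * r * h r ≤ 1/4 := by
      have := mul_le_mul hle hm h0 hr₀.1.le
      nlinarith [hr.1]
    have hs : √(r ^ 2 + 2 * r * h r) ≤ 1/2 := by
      rw [← hsq]; exact Real.sqrt_le_sqrt hq
    rw [min_eq_left hs, hΘ.1 r hr.1 hle, Real.arccos_eq_arcsin (by rw [add_comm]; positivity)]
    congr 1
    rw [add_comm (h r) r]
    have : 1 - (h r / (r + h r)) ^ 2 = (r ^ 2 + 2 * r * h r) / (r + h r) ^ 2 := by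
      field_simp; ring
    rw [this, Real.sqrt_div' _ (by positivity), Real.sqrt_sq hpos.le]
  · have hm : h r₀ ≤ h r := hh.2.1 ⟨hr₀.1.le, hr₀.2⟩ ⟨hr.1.le, hr.2⟩ hlt.le
    have hq : 1/4 ≤ r ^ 2 + 2 * r * h r := by
      have := mul_le_mul hlt.le hm h00 hr.1.le
      nlinarith [hr₀.1]
    have hs : 1/2 ≤ √(r ^ 2 + 2 * r * h r) := by
      rw [← hsq]; exact Real.sqrt_le_sqrt hq
    rw [min_eq_right hs]
    refine ⟨?_, fun _ => rfl⟩
    rw [hΘ.2 r hlt hr.2]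
    congr 1
    rw [add_comm (h r) r]
    field_simp

/-- The collected properties of `h` and `Θ` at a point `r`. -/
structure PtData (h Θ : ℝ → ℝ) (r₀ r : ℝ) : Prop where
  rpos : 0 < r
  rlt : r < 1/2
  hnn : 0 ≤ h r
  hdnn : 0 ≤ deriv h r
  tpos : 0 < Θ r
  tle : Θ r ≤ Real.pi / 2
  tle' : Θ r ≤ 1 / (r + h r)
  sinle : (r + h r) * Real.sin (Θ r) ≤ 1/2
  sineq : r₀ < r → (r + h r) * Real.sin (Θ r) = 1/2
  cosge : h r ≤ (r + h r) * Real.cos (Θ r)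

lemma ptData {h : ℝ → ℝ} (hh : GoodH h)
    {r₀ : ℝ} (hr₀ : r₀ ∈ Ioo (0:ℝ) (1/2)) (hr₀eq : 2 * r₀ * h r₀ + r₀ ^ 2 = 1/4)
    {Θ : ℝ → ℝ} (hΘ : GoodTheta h r₀ Θ) {r : ℝ} (hr : r ∈ Ioo (0:ℝ) (1/2)) :
    PtData h Θ r₀ r := by
  have h0 := goodH_nonneg hh hr
  have hrp := hr.1
  have hpos : 0 < r + h r := by linarith [hr.1]
  obtain ⟨hT, hT2⟩ := theta_formula hh hr₀ hr₀eq hΘ hr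
  set m := min (√(r ^ 2 + 2 * r * h r)) (1/2) with hm
  have hm0 : 0 < m := lt_min (Real.sqrt_pos.2 (by positivity)) (by norm_num)
  have hm1 : m ≤ 1/2 := min_le_right _ _
  have hm2 : m ^ 2 ≤ r ^ 2 + 2 * r * h r := by
    calc m ^ 2 ≤ (√(r ^ 2 + 2 * r * h r)) ^ 2 := by
          gcongr; exact min_le_left _ _
      _ = _ := Real.sq_sqrt (by positivity)
  have hm3 : m ≤ r + h r := by
    apply le_of_sq_le_sq _ hpos.le
    nlinarith [sq_nonneg (h r)]
  have hq1 : m / (r + h r) ≤ 1 := (div_le_one hpos).2 hm3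
  have hq0 : 0 < m / (r + h r) := by positivity
  have hsin : Real.sin (Θ r) = m / (r + h r) := by
    rw [hT]; exact Real.sin_arcsin (by linarith) hq1
  have hsin' : (r + h r) * Real.sin (Θ r) = m := by
    rw [hsin]; field_simp
  have htp : 0 < Θ r := by rw [hT]; exact Real.arcsin_pos.2 hq0
  have htl : Θ r ≤ Real.pi / 2 := by rw [hT]; exact Real.arcsin_le_pi_div_two _
  have hcos : 0 ≤ Real.cos (Θ r) := Real.cos_nonneg_of_neg_pi_div_two_le_of_le (by linarith [Real.pi_pos]) htl
  refine ⟨hr.1, hr.2, h0, goodH_deriv_nonneg hh hr, htp, htl, ?_, by rw [hsin']; exact hm1,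
    fun hc => by rw [hsin']; exact hT2 hc, ?_⟩
  · have h1 := Real.mul_le_sin htp.le htl
    have h2 : 2 / 4 * Θ r ≤ 2 / Real.pi * Θ r := by
      gcongr
      · exact Real.pi_le_four
    rw [le_div_iff₀ hpos]
    nlinarith
  · apply le_of_sq_le_sq _ (by positivity)
    have := Real.sin_sq_add_cos_sq (Θ r)
    have e : ((r + h r) * Real.cos (Θ r)) ^ 2 = (r + h r) ^ 2 - ((r + h r) * Real.sin (Θ r)) ^ 2 := by
      linear_combination (r + h r) ^ 2 * this
    rw [e, hsin']
    nlinarith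

lemma theta_continuousOn {h : ℝ → ℝ} (hh : GoodH h)
    {r₀ : ℝ} (hr₀ : r₀ ∈ Ioo (0:ℝ) (1/2)) (hr₀eq : 2 * r₀ * h r₀ + r₀ ^ 2 = 1/4)
    {Θ : ℝ → ℝ} (hΘ : GoodTheta h r₀ Θ) : ContinuousOn Θ (Ioo (0:ℝ) (1/2)) := by
  have hc := goodH_continuousOn hh
  have : ContinuousOn (fun r => Real.arcsin (min (√(r ^ 2 + 2 * r * h r)) (1/2) / (r + h r)))
      (Ioo (0:ℝ) (1/2)) := by
    apply Real.continuous_arcsin.comp_continuousOn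
    apply ContinuousOn.div
    · refine ContinuousOn.inf ?_ continuousOn_const
      apply ContinuousOn.sqrt
      fun_prop
    · fun_prop
    · intro r hr
      have := goodH_nonneg hh hr
      linarith [hr.1]
  exact this.congr fun r hr => (theta_formula hh hr₀ hr₀eq hΘ hr).1

/-! ### The boundary -/

lemma theta_pm_one {h Θ : ℝ → ℝ} {r₀ r θ : ℝ} (P : PtData h Θ r₀ r) (hθ : θ ∈ Icc (-1:ℝ) 1)
    (hb : |(r + h r) * Real.sin (θ * Θ r)| = 1/2 ∨ (r + h r) * Real.cos (θ * Θ r) - h r = 0) :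
    θ = -1 ∨ θ = 1 := by
  obtain ⟨h1, h2, h3, h4, h5, h6, h7, h8, h9, h10⟩ := P
  have hpi := Real.pi_pos
  have hpos : 0 < r + h r := by linarith
  by_contra! hne
  have hlt : |θ| < 1 := abs_lt.2 ⟨lt_of_le_of_ne hθ.1 (Ne.symm hne.1), lt_of_le_of_ne hθ.2 hne.2⟩
  have hab : |θ * Θ r| < Θ r := by
    rw [abs_mul, abs_of_pos h5]; nlinarith
  have hab0 := abs_nonneg (θ * Θ r)
  rcases hb with hb | hb
  · have : |Real.sin (θ * Θ r)| < Real.sin (Θ r) := by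
      rw [Real.abs_sin_eq_sin_abs_of_abs_le_pi (by linarith)]
      exact Real.sin_lt_sin_of_lt_of_le_pi_div_two (by linarith) h6 hab
    rw [abs_mul, abs_of_pos hpos] at hb
    nlinarith
  · have : Real.cos (Θ r) < Real.cos (θ * Θ r) := by
      rw [← Real.cos_abs (θ * Θ r)]
      exact Real.cos_lt_cos_of_nonneg_of_le_pi_div_two hab0 h6 hab
    nlinarith

/-! ### The primitive of the weight and the functions `g_r` -/

/-- The explicit primitive of the weight `w_r`. -/
def prim (h Θ : ℝ → ℝ) (r θ : ℝ) : ℝ :=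
  (1 + deriv h r) * θ - deriv h r * (Real.sin (θ * Θ r) / Θ r)

lemma prim_neg (h Θ : ℝ → ℝ) (r θ : ℝ) : prim h Θ r (-θ) = -prim h Θ r θ := by
  unfold prim
  rw [neg_mul, Real.sin_neg]; ring

lemma prim_zero (h Θ : ℝ → ℝ) (r : ℝ) : prim h Θ r 0 = 0 := by
  simp [prim]

lemma wgt_continuous (h Θ : ℝ → ℝ) (r : ℝ) : Continuous (wgt h Θ r) := by
  unfold wgt; fun_prop

lemma integral_wgt {h Θ : ℝ → ℝ} {r : ℝ} (ht : Θ r ≠ 0) (a b : ℝ) :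
    ∫ θ in a..b, wgt h Θ r θ = prim h Θ r b - prim h Θ r a := by
  apply intervalIntegral.integral_eq_sub_of_hasDerivAt
  · intro x _
    unfold wgt
    have h1 : HasDerivAt (fun θ : ℝ => θ * Θ r) (Θ r) x := by
      simpa using (hasDerivAt_id x).mul_const (Θ r)
    have h2 := ((h1.sin.div_const (Θ r)).const_mul (deriv h r))
    have h3 := ((hasDerivAt_id x).const_mul (1 + deriv h r)).sub h2
    refine h3.congr_deriv ?_
    field_simp
  · exact (wgt_continuous h Θ r).intervalIntegrable _ _

lemma le_wgt {h Θ : ℝ → ℝ} {r₀ r : ℝ} (P : PtData h Θ r₀ r) (θ : ℝ) : 1 ≤ wgt h Θ r θ := by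
  unfold wgt
  nlinarith [P.hdnn, Real.cos_le_one (θ * Θ r)]

lemma sub_le_prim_sub {h Θ : ℝ → ℝ} {r₀ r : ℝ} (P : PtData h Θ r₀ r) {a b : ℝ} (hab : a ≤ b) :
    b - a ≤ prim h Θ r b - prim h Θ r a := by
  rw [← integral_wgt P.tpos.ne']
  have : ∫ θ in a..b, (1:ℝ) ≤ ∫ θ in a..b, wgt h Θ r θ :=
    intervalIntegral.integral_mono_on hab (by simp)
      ((wgt_continuous h Θ r).intervalIntegrable _ _) (fun x _ => le_wgt P x)
  simpa using this

lemma abs_sub_le_prim {h Θ : ℝ → ℝ} {r₀ r : ℝ} (P : PtData h Θ r₀ r) (a b : ℝ) :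
    |b - a| ≤ |prim h Θ r b - prim h Θ r a| := by
  rcases le_total a b with hab | hab
  · rw [abs_of_nonneg (by linarith)]
    exact (sub_le_prim_sub P hab).trans (le_abs_self _)
  · rw [abs_sub_comm, abs_sub_comm (prim h Θ r b), abs_of_nonneg (by linarith)]
    exact (sub_le_prim_sub P hab).trans (le_abs_self _)

lemma abs_sin_sub_le (x : ℝ) (hx : |x| ≤ 1) : |x - Real.sin x| ≤ |x| ^ 3 / 4 := by
  have key : ∀ y : ℝ, 0 ≤ y → y ≤ 1 → |y - Real.sin y| ≤ y ^ 3 / 4 := by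
    intro y hy hy1
    rcases hy.eq_or_lt with rfl | hy
    · simp
    · have h1 := Real.sin_gt_sub_cube hy
      have h2 := Real.sin_lt hy
      have h3 : 0 < y ^ 3 := by positivity
      rw [abs_of_pos (by linarith)]; linarith
  rcases abs_cases x with ⟨he, h0⟩ | ⟨he, h0⟩
  · rw [he]; exact key x h0 (he ▸ hx)
  · rw [he]
    have := key (-x) (by linarith) (he ▸ hx)
    rw [Real.sin_neg] at this
    rwa [show x - Real.sin x = -(-x - -Real.sin x) by ring, abs_neg]

/-- `W_r` is close to the identity when `h' Θ²` is small. -/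
lemma abs_prim_sub_le {h Θ : ℝ → ℝ} {r₀ r : ℝ} (P : PtData h Θ r₀ r) (ht1 : Θ r ≤ 1) {θ : ℝ}
    (hθ : θ ∈ Icc (-1:ℝ) 1) : |prim h Θ r θ - θ| ≤ deriv h r * Θ r ^ 2 := by
  have ht := P.tpos
  have hd := P.hdnn
  have hθ1 : |θ| ≤ 1 := abs_le.2 hθ
  have ha : |θ * Θ r| ≤ Θ r := by
    rw [abs_mul, abs_of_pos ht]; nlinarith
  have e : prim h Θ r θ - θ = deriv h r * ((θ * Θ r - Real.sin (θ * Θ r)) / Θ r) := by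
    unfold prim; field_simp; ring
  rw [e, abs_mul, abs_of_nonneg hd]
  apply mul_le_mul_of_nonneg_left _ hd
  rw [abs_div, abs_of_pos ht, div_le_iff₀ ht]
  have h1 := abs_sin_sub_le _ (ha.trans ht1)
  have h2 : |θ * Θ r| ^ 3 ≤ Θ r ^ 3 := pow_le_pow_left₀ (abs_nonneg _) ha 3
  have h3 : 0 < Θ r ^ 3 := by positivity
  nlinarith

lemma g_mem {h Θ : ℝ → ℝ} {δ : ℝ} {g : ℝ → ℝ → ℝ} (hg : IsGFamily h Θ δ g)
    {r θ : ℝ} (hr : r ∈ Ioo (0:ℝ) (1/2)) (hθ : θ ∈ Icc (-1:ℝ) 1) : g r θ ∈ Icc (-1:ℝ) 1 :=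
  (hg r hr).2.1.mapsTo hθ

/-- The equation satisfied by `g_r`. -/
lemma prim_g {h Θ : ℝ → ℝ} {r₀ r : ℝ} (P : PtData h Θ r₀ r) {δ : ℝ} {g : ℝ → ℝ → ℝ}
    (hg : IsGFamily h Θ δ g) {θ : ℝ} (hθ : θ ∈ Icc (-1:ℝ) 1) :
    prim h Θ r (g r θ) = prim h Θ r θ + δ * (prim h Θ r 1 - |prim h Θ r θ|) := by
  obtain ⟨-, -, -, -, h1, h2⟩ := hg r ⟨P.rpos, P.rlt⟩
  have hne := P.tpos.ne'
  rcases le_total θ 0 with h0 | h0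
  · have := h1 θ ⟨hθ.1, h0⟩
    have h3 := sub_le_prim_sub P h0
    rw [prim_zero] at h3
    rw [integral_wgt hne, integral_wgt hne, prim_neg] at this
    rw [abs_of_nonpos (by linarith)]
    linear_combination -this
  · have := h2 θ ⟨h0, hθ.2⟩
    have h3 := sub_le_prim_sub P h0
    rw [prim_zero] at h3
    rw [integral_wgt hne, integral_wgt hne] at this
    rw [abs_of_nonneg (by linarith)]
    linear_combination this

lemma prim_continuousOn {h : ℝ → ℝ} (hh : GoodH h)
    {r₀ : ℝ} (hr₀ : r₀ ∈ Ioo (0:ℝ) (1/2)) (hr₀eq : 2 * r₀ * h r₀ + r₀ ^ 2 = 1/4)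
    {Θ : ℝ → ℝ} (hΘ : GoodTheta h r₀ Θ) :
    ContinuousOn (fun p : ℝ × ℝ => prim h Θ p.1 p.2) (Ioo (0:ℝ) (1/2) ×ˢ univ) := by
  have c1 : ContinuousOn (fun p : ℝ × ℝ => deriv h p.1) (Ioo (0:ℝ) (1/2) ×ˢ univ) :=
    (goodH_continuousOn_deriv hh).comp continuousOn_fst fun p hp => hp.1
  have c2 : ContinuousOn (fun p : ℝ × ℝ => Θ p.1) (Ioo (0:ℝ) (1/2) ×ˢ univ) :=
    (theta_continuousOn hh hr₀ hr₀eq hΘ).comp continuousOn_fst fun p hp => hp.1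
  unfold prim
  have c3 : ContinuousOn (fun p : ℝ × ℝ => Real.sin (p.2 * Θ p.1) / Θ p.1)
      (Ioo (0:ℝ) (1/2) ×ˢ univ) :=
    ContinuousOn.div (Real.continuous_sin.comp_continuousOn (continuousOn_snd.mul c2)) c2 fun p hp => (ptData hh hr₀ hr₀eq hΘ hp.1).tpos.ne'
  fun_prop

lemma g_continuousOn {h : ℝ → ℝ} (hh : GoodH h)
    {r₀ : ℝ} (hr₀ : r₀ ∈ Ioo (0:ℝ) (1/2)) (hr₀eq : 2 * r₀ * h r₀ + r₀ ^ 2 = 1/4)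
    {Θ : ℝ → ℝ} (hΘ : GoodTheta h r₀ Θ) {δ : ℝ} {g : ℝ → ℝ → ℝ} (hg : IsGFamily h Θ δ g) :
    ContinuousOn (fun p : ℝ × ℝ => g p.1 p.2) (Ioo (0:ℝ) (1/2) ×ˢ Icc (-1:ℝ) 1) := by
  set B := Ioo (0:ℝ) (1/2) ×ˢ Icc (-1:ℝ) 1 with hB
  have cW := prim_continuousOn hh hr₀ hr₀eq hΘ
  have c0 : ContinuousOn (fun p : ℝ × ℝ => prim h Θ p.1 p.2) B :=
    cW.mono (prod_mono_right (subset_univ _))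
  have cc : ∀ t : ℝ, ContinuousOn (fun p : ℝ × ℝ => prim h Θ p.1 t) B := fun t =>
    cW.comp (f := fun p : ℝ × ℝ => (p.1, t)) (by fun_prop) fun p hp => ⟨hp.1, mem_univ _⟩
  have c1 := cc 1
  have cR : ContinuousOn (fun p : ℝ × ℝ => prim h Θ p.1 (g p.1 p.2)) B := by
    have : ContinuousOn (fun p : ℝ × ℝ => prim h Θ p.1 p.2 +
      δ * (prim h Θ p.1 1 - |prim h Θ p.1 p.2|)) B := by fun_prop
    exact this.congr fun p hp => prim_g (ptData hh hr₀ hr₀eq hΘ hp.1) hg hp.2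
  intro q hq
  have l1 := cR q hq
  have l2 := cc (g q.1 q.2) q hq
  have l3 := (l1.sub l2).norm
  simp only [ContinuousWithinAt, Pi.sub_apply, sub_self, norm_zero] at l3
  refine tendsto_iff_norm_sub_tendsto_zero.2 ?_
  refine squeeze_zero' (Eventually.of_forall fun _ => norm_nonneg _) ?_ l3
  filter_upwards [self_mem_nhdsWithin] with p hp
  exact abs_sub_le_prim (ptData hh hr₀ hr₀eq hΘ hp.1) _ _

/-! ### Continuity of `K` -/

lemma K_mem {h Θ : ℝ → ℝ} {K : ℝ × ℝ → ℝ × ℝ} (hK : GoodK h Θ K) {x : ℝ × ℝ}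
    (hx : x ∈ lowerDom) : (K x).1 ∈ Ioo (0:ℝ) (1/2) ∧ (K x).2 ∈ Icc (-1:ℝ) 1 :=
  hK.1.mapsTo hx

lemma snd_le_r {h : ℝ → ℝ} (hh : GoodH h) {Θ : ℝ → ℝ} {K : ℝ × ℝ → ℝ × ℝ} (hK : GoodK h Θ K)
    {x : ℝ × ℝ} (hx : x ∈ lowerDom) : x.2 ≤ (K x).1 := by
  have hr := (K_mem hK hx).1
  have h0 := goodH_nonneg hh hr
  have hrp := hr.1
  have := (hK.2 x hx).2
  have hc := Real.cos_le_one ((K x).2 * Θ (K x).1)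
  nlinarith

lemma r_eq {h : ℝ → ℝ} {Θ : ℝ → ℝ} {K : ℝ × ℝ → ℝ × ℝ} (hK : GoodK h Θ K)
    {x : ℝ × ℝ} (hx : x ∈ lowerDom) :
    (K x).1 ^ 2 + 2 * ((K x).1 - x.2) * h (K x).1 = (x.1 - 1/2) ^ 2 + x.2 ^ 2 := by
  obtain ⟨h1, h2⟩ := hK.2 x hx
  have h3 := Real.sin_sq_add_cos_sq ((K x).2 * Θ (K x).1)
  have e1 : x.1 - 1/2 = ((K x).1 + h (K x).1) * Real.sin ((K x).2 * Θ (K x).1) := by linarith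
  have e2 : x.2 + h (K x).1 = ((K x).1 + h (K x).1) * Real.cos ((K x).2 * Θ (K x).1) := by linarith
  have : (x.1 - 1/2) ^ 2 + (x.2 + h (K x).1) ^ 2 = ((K x).1 + h (K x).1) ^ 2 := by
    rw [e1, e2]; linear_combination ((K x).1 + h (K x).1) ^ 2 * h3
  linear_combination -this

lemma r_gt {h : ℝ → ℝ} (hh : GoodH h) {Θ : ℝ → ℝ} {K : ℝ × ℝ → ℝ × ℝ} (hK : GoodK h Θ K)
    {x : ℝ × ℝ} (hx : x ∈ lowerDom) {s : ℝ} (hs0 : 0 ≤ s) (hs : s < (K x).1) :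
    s ^ 2 + 2 * (s - x.2) * h s < (x.1 - 1/2) ^ 2 + x.2 ^ 2 := by
  have hr := (K_mem hK hx).1
  have hs' : s ∈ Ico (0:ℝ) (1/2) := ⟨hs0, hs.trans hr.2⟩
  have hm := hh.2.1 hs' ⟨hr.1.le, hr.2⟩ hs.le
  have h0 := hh.1 s hs'
  rcases le_or_gt x.2 s with hl | hl
  · rw [← r_eq hK hx]
    have : (s - x.2) * h s ≤ ((K x).1 - x.2) * h (K x).1 :=
      mul_le_mul (by linarith) hm h0 (by linarith)
    nlinarith
  · have : 0 ≤ (x.2 - s) * h s := mul_nonneg (by linarith) h0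
    nlinarith [sq_nonneg (x.1 - 1/2)]

lemma r_lt {h : ℝ → ℝ} (hh : GoodH h) {Θ : ℝ → ℝ} {K : ℝ × ℝ → ℝ × ℝ} (hK : GoodK h Θ K)
    {x : ℝ × ℝ} (hx : x ∈ lowerDom) {s : ℝ} (hs0 : s < 1/2) (hs : (K x).1 < s) :
    (x.1 - 1/2) ^ 2 + x.2 ^ 2 < s ^ 2 + 2 * (s - x.2) * h s := by
  have hr := (K_mem hK hx).1
  have hs' : s ∈ Ico (0:ℝ) (1/2) := ⟨(hr.1.trans hs).le, hs0⟩
  have hm := hh.2.1 ⟨hr.1.le, hr.2⟩ hs' hs.le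
  have h0 := goodH_nonneg hh hr
  have hl := snd_le_r hh hK hx
  rw [← r_eq hK hx]
  have : ((K x).1 - x.2) * h (K x).1 ≤ (s - x.2) * h s :=
    mul_le_mul (by linarith) hm h0 (by linarith)
  nlinarith [hr.1]

lemma r_continuousOn {h : ℝ → ℝ} (hh : GoodH h) {Θ : ℝ → ℝ} {K : ℝ × ℝ → ℝ × ℝ}
    (hK : GoodK h Θ K) : ContinuousOn (fun x => (K x).1) lowerDom := by
  intro x hx
  have hr := (K_mem hK hx).1
  refine tendsto_order.2 ⟨fun s hs => ?_, fun s hs => ?_⟩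
  · rcases lt_or_ge s 0 with h0 | h0
    · filter_upwards [self_mem_nhdsWithin] with y hy
      exact h0.trans (K_mem hK hy).1.1
    · have h1 := r_gt hh hK hx h0 hs
      have h2 : ∀ᶠ y in nhdsWithin x lowerDom,
          s ^ 2 + 2 * (s - y.2) * h s < (y.1 - 1/2) ^ 2 + y.2 ^ 2 :=
        mem_nhdsWithin_of_mem_nhds
          ((isOpen_lt (by fun_prop) (by fun_prop)).mem_nhds h1)
      filter_upwards [h2, self_mem_nhdsWithin] with y hy hyd
      by_contra! hc
      rcases hc.eq_or_lt with he | hlt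
      · have := r_eq hK hyd
        rw [he] at this; linarith
      · have := r_lt hh hK hyd (hs.trans hr.2) hlt
        linarith
  · rcases le_or_gt (1/2) s with h0 | h0
    · filter_upwards [self_mem_nhdsWithin] with y hy
      exact (K_mem hK hy).1.2.trans_le h0
    · have h1 := r_lt hh hK hx h0 hs
      have h2 : ∀ᶠ y in nhdsWithin x lowerDom,
          (y.1 - 1/2) ^ 2 + y.2 ^ 2 < s ^ 2 + 2 * (s - y.2) * h s :=
        mem_nhdsWithin_of_mem_nhds
          ((isOpen_lt (by fun_prop) (by fun_prop)).mem_nhds h1)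
      filter_upwards [h2, self_mem_nhdsWithin] with y hy hyd
      by_contra! hc
      rcases hc.eq_or_lt with he | hlt
      · have := r_eq hK hyd
        rw [← he] at this; linarith
      · have := r_gt hh hK hyd (hr.1.trans hs).le hlt
        linarith

lemma K_continuousOn {h : ℝ → ℝ} (hh : GoodH h)
    {r₀ : ℝ} (hr₀ : r₀ ∈ Ioo (0:ℝ) (1/2)) (hr₀eq : 2 * r₀ * h r₀ + r₀ ^ 2 = 1/4)
    {Θ : ℝ → ℝ} (hΘ : GoodTheta h r₀ Θ) {K : ℝ × ℝ → ℝ × ℝ}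
    (hK : GoodK h Θ K) : ContinuousOn K lowerDom := by
  have c1 := r_continuousOn hh hK
  have c2 : ContinuousOn (fun x => Θ (K x).1) lowerDom :=
    (theta_continuousOn hh hr₀ hr₀eq hΘ).comp c1 fun x hx => (K_mem hK hx).1
  have c3 : ContinuousOn (fun x => h (K x).1) lowerDom :=
    (goodH_continuousOn hh).comp c1 fun x hx => (K_mem hK hx).1
  have c4 : ContinuousOn (fun x : ℝ × ℝ => Real.arcsin ((x.1 - 1/2) / ((K x).1 + h (K x).1))
      / Θ (K x).1) lowerDom := by
    refine ContinuousOn.div (Real.continuous_arcsin.comp_continuousOn ?_) c2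
      fun x hx => (ptData hh hr₀ hr₀eq hΘ (K_mem hK hx).1).tpos.ne'
    refine ContinuousOn.div (by fun_prop) (c1.add c3) fun x hx => ?_
    have P := (ptData hh hr₀ hr₀eq hΘ (K_mem hK hx).1)
    have := P.rpos
    have := P.hnn
    linarith
  have c5 : ContinuousOn (fun x => (K x).2) lowerDom := by
    refine c4.congr fun x hx => ?_
    have P := (ptData hh hr₀ hr₀eq hΘ (K_mem hK hx).1)
    have hp : 0 < (K x).1 + h (K x).1 := by linarith [P.rpos, P.hnn]
    have ht := P.tpos
    have h1 := (hK.2 x hx).1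
    have hθ := (K_mem hK hx).2
    have e : (x.1 - 1/2) / ((K x).1 + h (K x).1) = Real.sin ((K x).2 * Θ (K x).1) := by
      rw [div_eq_iff hp.ne']; linarith
    simp only
    rw [e, Real.arcsin_sin]
    · field_simp
    · nlinarith [P.tle, hθ.1]
    · nlinarith [P.tle, hθ.2]
  exact c1.prodMk c5

/-! ### `Ψ` on the lower half -/

lemma psi_formula {h Θ : ℝ → ℝ} {K : ℝ × ℝ → ℝ × ℝ} (hK : GoodK h Θ K) {δ : ℝ}
    {g : ℝ → ℝ → ℝ} {Ψ : ℝ × ℝ → ℝ × ℝ} (hΨ : IsPsi K δ g Ψ) {x : ℝ × ℝ} (hx : x ∈ lowerDom) :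
    (Ψ x).1 = 1/2 + ((K x).1 + h (K x).1) * Real.sin (g (K x).1 (K x).2 * Θ (K x).1) ∧
    (Ψ x).2 = ((K x).1 + h (K x).1) * Real.cos (g (K x).1 (K x).2 * Θ (K x).1) - h (K x).1 := by
  obtain ⟨h1, h2, h3⟩ := hΨ.1 x hx
  have := hK.2 (Ψ x) h1
  rwa [h2, h3] at this

lemma psi_continuousOn_lowerDom {h : ℝ → ℝ} (hh : GoodH h)
    {r₀ : ℝ} (hr₀ : r₀ ∈ Ioo (0:ℝ) (1/2)) (hr₀eq : 2 * r₀ * h r₀ + r₀ ^ 2 = 1/4)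
    {Θ : ℝ → ℝ} (hΘ : GoodTheta h r₀ Θ) {K : ℝ × ℝ → ℝ × ℝ}
    (hK : GoodK h Θ K) {δ : ℝ} {g : ℝ → ℝ → ℝ} (hg : IsGFamily h Θ δ g)
    {Ψ : ℝ × ℝ → ℝ × ℝ} (hΨ : IsPsi K δ g Ψ) : ContinuousOn Ψ lowerDom := by
  have c0 := K_continuousOn hh hr₀ hr₀eq hΘ hK
  have c1 := r_continuousOn hh hK
  have c2 : ContinuousOn (fun x => Θ (K x).1) lowerDom :=
    (theta_continuousOn hh hr₀ hr₀eq hΘ).comp c1 fun x hx => (K_mem hK hx).1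
  have c3 : ContinuousOn (fun x => h (K x).1) lowerDom :=
    (goodH_continuousOn hh).comp c1 fun x hx => (K_mem hK hx).1
  have c4 : ContinuousOn (fun x => g (K x).1 (K x).2) lowerDom :=
    (g_continuousOn hh hr₀ hr₀eq hΘ hg).comp c0 fun x hx => K_mem hK hx
  have c5 := c4.mul c2
  have c6 := Real.continuous_sin.comp_continuousOn c5
  have c7 := Real.continuous_cos.comp_continuousOn c5
  have f1 : ContinuousOn (fun x => (Ψ x).1) lowerDom :=
    (continuousOn_const.add ((c1.add c3).mul c6)).congr fun x hx => (psi_formula hK hΨ hx).1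
  have f2 : ContinuousOn (fun x => (Ψ x).2) lowerDom :=
    (((c1.add c3).mul c7).sub c3).congr fun x hx => (psi_formula hK hΨ hx).2
  exact f1.prodMk f2

/-- Continuity at the singular point `(1/2, 0)`. -/
lemma psi_tendsto_center {h : ℝ → ℝ} (hh : GoodH h) {Θ : ℝ → ℝ} {K : ℝ × ℝ → ℝ × ℝ}
    (hK : GoodK h Θ K) {δ : ℝ} {g : ℝ → ℝ → ℝ}
    {Ψ : ℝ × ℝ → ℝ × ℝ} (hΨ : IsPsi K δ g Ψ) :
    Tendsto Ψ (nhdsWithin (1/2, 0) lowerDom) (nhds (1/2, 0)) := by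
  have hr : Tendsto (fun x => (K x).1) (nhdsWithin (1/2, 0) lowerDom) (nhds 0) := by
    have l : Tendsto (fun x : ℝ × ℝ => √((x.1 - 1/2) ^ 2 + x.2 ^ 2))
        (nhdsWithin (1/2, 0) lowerDom) (nhds 0) := by
      have : Continuous (fun x : ℝ × ℝ => √((x.1 - 1/2) ^ 2 + x.2 ^ 2)) := by fun_prop
      have h2 := this.tendsto (1/2, 0)
      simp only [sub_self] at h2
      norm_num at h2
      norm_num
      exact h2.mono_left nhdsWithin_le_nhds
    refine squeeze_zero' ?_ ?_ l
    · filter_upwards [self_mem_nhdsWithin] with x hx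
      exact (K_mem hK hx).1.1.le
    · filter_upwards [self_mem_nhdsWithin] with x hx
      apply Real.le_sqrt_of_sq_le
      rw [← r_eq hK hx]
      nlinarith [mul_nonneg (sub_nonneg.2 (snd_le_r hh hK hx)) (goodH_nonneg hh (K_mem hK hx).1)]
  have hsmall : ∀ᶠ x in nhdsWithin (1/2, 0) lowerDom, (K x).1 < 1/10 :=
    hr.eventually_lt_const (by norm_num)
  have f1 : Tendsto (fun x => (Ψ x).1) (nhdsWithin (1/2, 0) lowerDom) (nhds (1/2)) := by
    rw [tendsto_iff_norm_sub_tendsto_zero]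
    refine squeeze_zero' (Eventually.of_forall fun _ => norm_nonneg _) ?_ hr
    filter_upwards [self_mem_nhdsWithin, hsmall] with x hx hs
    have hrm := (K_mem hK hx).1
    rw [(psi_formula hK hΨ hx).1, hh.2.2.1 _ ⟨hrm.1.le, hs.le⟩, add_sub_cancel_left, add_zero,
      norm_mul, Real.norm_of_nonneg hrm.1.le]
    exact mul_le_of_le_one_right hrm.1.le (Real.abs_sin_le_one _)
  have f2 : Tendsto (fun x => (Ψ x).2) (nhdsWithin (1/2, 0) lowerDom) (nhds 0) := by
    rw [tendsto_iff_norm_sub_tendsto_zero]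
    refine squeeze_zero' (Eventually.of_forall fun _ => norm_nonneg _) ?_ hr
    filter_upwards [self_mem_nhdsWithin, hsmall] with x hx hs
    have hrm := (K_mem hK hx).1
    rw [(psi_formula hK hΨ hx).2, hh.2.2.1 _ ⟨hrm.1.le, hs.le⟩, sub_zero, sub_zero, add_zero,
      norm_mul, Real.norm_of_nonneg hrm.1.le]
    exact mul_le_of_le_one_right hrm.1.le (Real.abs_cos_le_one _)
  exact f1.prodMk_nhds f2

/-! ### Behaviour near the middle line -/

/-- The map to which `Ψ` is close near the line `x₂ = 1/2`. -/
def lineMap (δ : ℝ) (x : ℝ × ℝ) : ℝ × ℝ := (x.1 + δ * (1/2 - |x.1 - 1/2|), x.2)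

lemma lineMap_continuous (δ : ℝ) : Continuous (lineMap δ) := by
  unfold lineMap; fun_prop

lemma psi_line {K : ℝ × ℝ → ℝ × ℝ} {δ : ℝ} {g : ℝ → ℝ → ℝ} {Ψ : ℝ × ℝ → ℝ × ℝ}
    (hΨ : IsPsi K δ g Ψ) {x : ℝ × ℝ} (hx : x.1 ∈ Icc (0:ℝ) 1) (hx2 : x.2 = 1/2) :
    Ψ x = lineMap δ x := by
  obtain ⟨a, b⟩ := x
  simp only at hx hx2
  subst hx2
  obtain ⟨-, -, -, h1, h2⟩ := hΨ
  unfold lineMap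
  rcases le_total a (1/2) with ha | ha
  · rw [h1 a hx.1 ha]
    simp only [Prod.mk.injEq, and_true]
    rw [abs_of_nonpos (by linarith)]; ring
  · rw [h2 a ha hx.2]
    simp only [Prod.mk.injEq, and_true]
    rw [abs_of_nonneg (by linarith)]; ring

lemma abs_scaled_sin_le {h Θ : ℝ → ℝ} {r₀ r : ℝ} (P : PtData h Θ r₀ r) (hr : r₀ < r)
    (hu : 1 / (r + h r) ≤ 1) {t : ℝ} (ht : t ∈ Icc (-1:ℝ) 1) :
    |(r + h r) * Real.sin (t * Θ r) - t / 2| ≤ 1 / (r + h r) := by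
  have hp : 0 < r + h r := by linarith [P.rpos, P.hnn]
  have hT := P.tpos
  have hTu := P.tle'
  have ht1 : |t| ≤ 1 := abs_le.2 ht
  have ha : |t * Θ r| ≤ Θ r := by
    rw [abs_mul, abs_of_pos hT]; nlinarith
  have hs := P.sineq hr
  set u := 1 / (r + h r) with hu'
  have hup : 0 < u := by positivity
  have hur : (r + h r) * u = 1 := by rw [hu']; field_simp
  have h1 := abs_sin_sub_le (t * Θ r) (by linarith)
  have h2 := abs_sin_sub_le (Θ r) (by rw [abs_of_pos hT]; linarith)
  have h3 : |t * Θ r| ^ 3 ≤ Θ r ^ 3 := pow_le_pow_left₀ (abs_nonneg _) ha 3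
  rw [abs_of_pos hT] at h2
  have h4 : Θ r ^ 3 ≤ u ^ 3 := pow_le_pow_left₀ hT.le hTu 3
  have h5 : |t * (Θ r - Real.sin (Θ r))| ≤ Θ r ^ 3 / 4 := by
    rw [abs_mul]; nlinarith [abs_nonneg (Θ r - Real.sin (Θ r)), abs_nonneg t]
  have h6 : |t * (Θ r - Real.sin (Θ r)) - (t * Θ r - Real.sin (t * Θ r))| ≤ u ^ 3 := by
    have := abs_sub (t * (Θ r - Real.sin (Θ r))) (t * Θ r - Real.sin (t * Θ r))
    have : 0 < u ^ 3 := by positivity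
    linarith
  have e : (r + h r) * Real.sin (t * Θ r) - t / 2 =
      (r + h r) * (t * (Θ r - Real.sin (Θ r)) - (t * Θ r - Real.sin (t * Θ r))) := by
    linear_combination t * hs
  rw [e, abs_mul, abs_of_pos hp]
  calc (r + h r) * _ ≤ (r + h r) * u ^ 3 := by gcongr
    _ = u ^ 2 := by linear_combination u ^ 2 * hur
    _ ≤ u := by nlinarith

lemma abs_g_sub_le {h Θ : ℝ → ℝ} {r₀ r : ℝ} (P : PtData h Θ r₀ r) {δ : ℝ}
    (hδ : δ ∈ Ioo (-1:ℝ) 1) {g : ℝ → ℝ → ℝ} (hg : IsGFamily h Θ δ g) (ht1 : Θ r ≤ 1) {θ : ℝ}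
    (hθ : θ ∈ Icc (-1:ℝ) 1) :
    |g r θ - (θ + δ * (1 - |θ|))| ≤ 4 * (deriv h r * Θ r ^ 2) := by
  have hδ1 : |δ| ≤ 1 := abs_le.2 ⟨hδ.1.le, hδ.2.le⟩
  have e1 := abs_prim_sub_le P ht1 hθ
  have e2 := abs_prim_sub_le P ht1 (g_mem hg ⟨P.rpos, P.rlt⟩ hθ)
  have e3 := abs_prim_sub_le P ht1 (show (1:ℝ) ∈ Icc (-1:ℝ) 1 by norm_num)
  have e4 := prim_g P hg hθ
  set e := deriv h r * Θ r ^ 2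
  have e5 := abs_abs_sub_abs_le_abs_sub (prim h Θ r θ) θ
  have e6 : |(prim h Θ r 1 - 1) - (|prim h Θ r θ| - |θ|)| ≤ 2 * e := by
    have := abs_sub (prim h Θ r 1 - 1) (|prim h Θ r θ| - |θ|)
    linarith
  have e7 : |δ * ((prim h Θ r 1 - 1) - (|prim h Θ r θ| - |θ|))| ≤ 2 * e := by
    rw [abs_mul]
    nlinarith [abs_nonneg ((prim h Θ r 1 - 1) - (|prim h Θ r θ| - |θ|)), abs_nonneg δ]
  have : g r θ - (θ + δ * (1 - |θ|)) = -(prim h Θ r (g r θ) - g r θ) + (prim h Θ r θ - θ)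
      + δ * ((prim h Θ r 1 - 1) - (|prim h Θ r θ| - |θ|)) := by
    linear_combination e4
  rw [this]
  refine (abs_add_three _ _ _).trans ?_
  rw [abs_neg]
  linarith

lemma psi_close {h Θ : ℝ → ℝ} {r₀ : ℝ} {K : ℝ × ℝ → ℝ × ℝ} (hK : GoodK h Θ K) {δ : ℝ}
    (hδ : δ ∈ Ioo (-1:ℝ) 1) {g : ℝ → ℝ → ℝ} (hg : IsGFamily h Θ δ g)
    {Ψ : ℝ × ℝ → ℝ × ℝ} (hΨ : IsPsi K δ g Ψ) {x : ℝ × ℝ} (hx : x ∈ lowerDom)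
    (P : PtData h Θ r₀ (K x).1) (hr : r₀ < (K x).1) (hu : 1 / ((K x).1 + h (K x).1) ≤ 1) :
    |(Ψ x).1 - (lineMap δ x).1| ≤
      3 * (1 / ((K x).1 + h (K x).1)) + 2 * (deriv h (K x).1 * Θ (K x).1 ^ 2) ∧
    (K x).1 - 1 / ((K x).1 + h (K x).1) ≤ (Ψ x).2 := by
  obtain ⟨f1, f2⟩ := psi_formula hK hΨ hx
  have f0 := (hK.2 x hx).1
  have hθ := (K_mem hK hx).2
  generalize (K x).2 = θ at *
  generalize (K x).1 = r at *
  have hgm := g_mem hg ⟨P.rpos, P.rlt⟩ hθ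
  have hTu := P.tle'
  have hT := P.tpos
  have hp : 0 < r + h r := by linarith [P.rpos, P.hnn]
  constructor
  · have a1 := abs_scaled_sin_le P hr hu hgm
    have a2 := abs_scaled_sin_le P hr hu hθ
    have a3 := abs_g_sub_le P hδ hg (hTu.trans hu) hθ
    have hδ1 : |δ| ≤ 1 := abs_le.2 ⟨hδ.1.le, hδ.2.le⟩
    set u := 1 / (r + h r)
    set e := deriv h r * Θ r ^ 2
    have f0' : (r + h r) * Real.sin (θ * Θ r) = x.1 - 1/2 := by linarith
    have f1' : (r + h r) * Real.sin (g r θ * Θ r) = (Ψ x).1 - 1/2 := by linarith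
    rw [f1'] at a1
    rw [f0'] at a2
    have a4 := abs_abs_sub_abs_le_abs_sub (x.1 - 1/2) (θ / 2)
    have a5 : |δ * (|x.1 - 1/2| - |θ / 2|)| ≤ u := by
      rw [abs_mul]
      nlinarith [abs_nonneg (|x.1 - 1/2| - |θ / 2|), abs_nonneg δ]
    have e2 : |θ / 2| = |θ| / 2 := by rw [abs_div]; norm_num
    rw [e2] at a5
    simp only [lineMap]
    rw [abs_le] at *
    constructor <;> nlinarith
  · rw [f2]
    have hc := Real.one_sub_sq_div_two_le_cos (x := g r θ * Θ r)
    have hg1 : |g r θ| ≤ 1 := abs_le.2 hgm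
    have hsq : (g r θ * Θ r) ^ 2 ≤ (1 / (r + h r)) ^ 2 := by
      apply sq_le_sq'
      · nlinarith [hgm.1]
      · nlinarith [hgm.2]
    have : (r + h r) * (1 - (1 / (r + h r)) ^ 2) ≤ (r + h r) * Real.cos (g r θ * Θ r) := by
      apply mul_le_mul_of_nonneg_left _ hp.le
      nlinarith [sq_nonneg (1 / (r + h r))]
    have e : (r + h r) * (1 - (1 / (r + h r)) ^ 2) = r + h r - 1 / (r + h r) := by
      field_simp
    linarith

lemma psi_snd_le {h : ℝ → ℝ} (hh : GoodH h) {Θ : ℝ → ℝ} {K : ℝ × ℝ → ℝ × ℝ} (hK : GoodK h Θ K)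
    {δ : ℝ} {g : ℝ → ℝ → ℝ}
    {Ψ : ℝ × ℝ → ℝ × ℝ} (hΨ : IsPsi K δ g Ψ) {x : ℝ × ℝ} (hx : x ∈ lowerDom) :
    (Ψ x).2 ≤ (K x).1 := by
  have := snd_le_r hh hK (hΨ.1 x hx).1
  rwa [(hΨ.1 x hx).2.1] at this

/-- Continuity from below at the middle line. -/
lemma psi_tendsto_line {h : ℝ → ℝ} (hh : GoodH h)
    {r₀ : ℝ} (hr₀ : r₀ ∈ Ioo (0:ℝ) (1/2)) (hr₀eq : 2 * r₀ * h r₀ + r₀ ^ 2 = 1/4)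
    {Θ : ℝ → ℝ} (hΘ : GoodTheta h r₀ Θ) {K : ℝ × ℝ → ℝ × ℝ}
    (hK : GoodK h Θ K) {δ : ℝ} (hδ : δ ∈ Ioo (-1:ℝ) 1)
    {g : ℝ → ℝ → ℝ} (hg : IsGFamily h Θ δ g)
    {Ψ : ℝ × ℝ → ℝ × ℝ} (hΨ : IsPsi K δ g Ψ) (a : ℝ) :
    Tendsto Ψ (nhdsWithin (a, 1/2) lowerDom) (nhds (lineMap δ (a, 1/2))) := by
  set l := nhdsWithin ((a, 1/2) : ℝ × ℝ) lowerDom with hl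
  have hself : ∀ᶠ x in l, x ∈ lowerDom := self_mem_nhdsWithin
  have hr : Tendsto (fun x => (K x).1) l (nhds (1/2)) := by
    have h2 : Tendsto (fun x : ℝ × ℝ => x.2) l (nhds (1/2)) :=
      (continuous_snd.tendsto ((a, 1/2) : ℝ × ℝ)).mono_left nhdsWithin_le_nhds
    refine tendsto_of_tendsto_of_tendsto_of_le_of_le' h2 tendsto_const_nhds ?_ ?_
    · filter_upwards [hself] with x hx using snd_le_r hh hK hx
    · filter_upwards [hself] with x hx using (K_mem hK hx).1.2.le
  have hr' : Tendsto (fun x => (K x).1) l (nhdsWithin (1/2) (Iio (1/2))) :=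
    tendsto_nhdsWithin_iff.2 ⟨hr, by filter_upwards [hself] with x hx using (K_mem hK hx).1.2⟩
  have hH : Tendsto (fun x => h (K x).1) l atTop := hh.2.2.2.1.comp hr'
  have hS : Tendsto (fun x => (K x).1 + h (K x).1) l atTop := hr.add_atTop hH
  have hU : Tendsto (fun x => 1 / ((K x).1 + h (K x).1)) l (nhds 0) := by
    simp only [one_div]
    exact hS.inv_tendsto_atTop
  obtain ⟨c, hc⟩ := hh.2.2.2.2.2
  have hE : Tendsto (fun x => 3 * (1 / ((K x).1 + h (K x).1)) +
      2 * √(c * (1 / ((K x).1 + h (K x).1)))) l (nhds 0) := by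
    have := (hU.const_mul 3).add (((hU.const_mul c).sqrt).const_mul 2)
    simpa using this
  have hbig : ∀ᶠ x in l, r₀ < (K x).1 := hr.eventually_const_lt hr₀.2
  have hus : ∀ᶠ x in l, 1 / ((K x).1 + h (K x).1) ≤ 1 :=
    (hU.eventually_lt_const one_pos).mono fun x hx => hx.le
  have hT : Tendsto (lineMap δ) l (nhds (lineMap δ (a, 1/2))) :=
    ((lineMap_continuous δ).tendsto _).mono_left nhdsWithin_le_nhds
  have f1 : Tendsto (fun x => (Ψ x).1) l (nhds (lineMap δ (a, 1/2)).1) := by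
    have d : Tendsto (fun x => (Ψ x).1 - (lineMap δ x).1) l (nhds 0) := by
      refine squeeze_zero_norm' ?_ hE
      filter_upwards [hself, hbig, hus] with x hx hb hu
      have P := ptData hh hr₀ hr₀eq hΘ (K_mem hK hx).1
      refine (psi_close hK hδ hg hΨ hx P hb hu).1.trans ?_
      gcongr
      apply Real.le_sqrt_of_sq_le
      have hp : 0 < (K x).1 + h (K x).1 := by linarith [P.rpos, P.hnn]
      have h1 := (hc (K x).1 ⟨P.rpos.le, P.rlt⟩).1
      have h2 : Θ (K x).1 ^ 4 ≤ (1 / ((K x).1 + h (K x).1)) ^ 4 :=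
        pow_le_pow_left₀ P.tpos.le P.tle' 4
      calc (deriv h (K x).1 * Θ (K x).1 ^ 2) ^ 2
          = deriv h (K x).1 ^ 2 * Θ (K x).1 ^ 4 := by ring
        _ ≤ deriv h (K x).1 ^ 2 * (1 / ((K x).1 + h (K x).1)) ^ 4 := by gcongr
        _ ≤ (c * ((K x).1 + h (K x).1) ^ 3) * (1 / ((K x).1 + h (K x).1)) ^ 4 := by gcongr
        _ = c * (1 / ((K x).1 + h (K x).1)) := by field_simp
    have := d.add ((continuous_fst.tendsto _).comp hT)
    simpa using this
  have f2 : Tendsto (fun x => (Ψ x).2) l (nhds (1/2)) := by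
    have low := hr.sub hU
    rw [sub_zero] at low
    refine tendsto_of_tendsto_of_tendsto_of_le_of_le' low hr ?_ ?_
    · filter_upwards [hself, hbig, hus] with x hx hb hu
      exact (psi_close hK hδ hg hΨ hx (ptData hh hr₀ hr₀eq hΘ (K_mem hK hx).1) hb hu).2
    · filter_upwards [hself] with x hx using psi_snd_le hh hK hΨ hx
  exact f1.prodMk_nhds f2

/-! ### Assembling -/

/-- The closed lower half of the square. -/
def lowerHalf : Set (ℝ × ℝ) := Icc (0:ℝ) 1 ×ˢ Icc (0:ℝ) (1/2)

/-- The closed upper half of the square. -/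
def upperHalf : Set (ℝ × ℝ) := Icc (0:ℝ) 1 ×ˢ Icc (1/2:ℝ) 1

/-- Reflection in the middle line. -/
def reflect (x : ℝ × ℝ) : ℝ × ℝ := (x.1, 1 - x.2)

lemma reflect_reflect (x : ℝ × ℝ) : reflect (reflect x) = x := by
  simp [reflect]

lemma lowerHalf_cases {x : ℝ × ℝ} (hx : x ∈ lowerHalf) :
    x ∈ lowerDom ∨ x = (1/2, 0) ∨ x.2 = 1/2 := by
  rcases hx.2.2.eq_or_lt with he | hlt
  · exact Or.inr (Or.inr he)
  · by_cases hc : x = (1/2, 0)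
    · exact Or.inr (Or.inl hc)
    · exact Or.inl ⟨⟨hx.1, hx.2.1, hlt⟩, hc⟩

lemma lowerDom_subset : lowerDom ⊆ lowerHalf := fun _ hx => ⟨hx.1.1, hx.1.2.1, hx.1.2.2.le⟩

lemma psi_continuousOn_lowerHalf {h : ℝ → ℝ} (hh : GoodH h)
    {r₀ : ℝ} (hr₀ : r₀ ∈ Ioo (0:ℝ) (1/2)) (hr₀eq : 2 * r₀ * h r₀ + r₀ ^ 2 = 1/4)
    {Θ : ℝ → ℝ} (hΘ : GoodTheta h r₀ Θ) {K : ℝ × ℝ → ℝ × ℝ}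
    (hK : GoodK h Θ K) {δ : ℝ} (hδ : δ ∈ Ioo (-1:ℝ) 1)
    {g : ℝ → ℝ → ℝ} (hg : IsGFamily h Θ δ g)
    {Ψ : ℝ × ℝ → ℝ × ℝ} (hΨ : IsPsi K δ g Ψ) : ContinuousOn Ψ lowerHalf := by
  intro x hx
  rcases lowerHalf_cases hx with hd | rfl | h2
  · have := psi_continuousOn_lowerDom hh hr₀ hr₀eq hΘ hK hg hΨ x hd
    refine this.mono_of_mem_nhdsWithin ?_
    have o1 : {y : ℝ × ℝ | y.2 < 1/2} ∈ nhds x :=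
      (isOpen_lt continuous_snd continuous_const).mem_nhds hd.1.2.2
    have o2 : {((1/2, 0) : ℝ × ℝ)}ᶜ ∈ nhds x := isOpen_compl_singleton.mem_nhds hd.2
    filter_upwards [self_mem_nhdsWithin, mem_nhdsWithin_of_mem_nhds o1,
      mem_nhdsWithin_of_mem_nhds o2] with y hy h1 h2
    exact ⟨⟨hy.1, hy.2.1, h1⟩, h2⟩
  · have c1 : ContinuousWithinAt Ψ lowerDom (1/2, 0) := by
      rw [ContinuousWithinAt, hΨ.2.1]
      exact psi_tendsto_center hh hK hΨ
    have c2 := c1.union (continuousWithinAt_singleton (f := Ψ) (x := (1/2, 0)))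
    refine c2.mono_of_mem_nhdsWithin ?_
    have o1 : {y : ℝ × ℝ | y.2 < 1/2} ∈ nhds ((1/2, 0) : ℝ × ℝ) :=
      (isOpen_lt continuous_snd continuous_const).mem_nhds (by norm_num)
    filter_upwards [self_mem_nhdsWithin, mem_nhdsWithin_of_mem_nhds o1] with y hy h1
    rcases lowerHalf_cases hy with h | h | h
    · exact Or.inl h
    · exact Or.inr h
    · exact absurd h (ne_of_lt h1)
  · have e : Ψ x = lineMap δ x := psi_line hΨ hx.1 h2
    have c1 : ContinuousWithinAt Ψ lowerDom x := by
      rw [ContinuousWithinAt, e]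
      have := psi_tendsto_line hh hr₀ hr₀eq hΘ hK hδ hg hΨ x.1
      rwa [← h2] at this
    have c2 : ContinuousWithinAt Ψ (lowerHalf ∩ {y | y.2 = 1/2}) x :=
      ((lineMap_continuous δ).continuousWithinAt).congr
        (fun y hy => psi_line hΨ hy.1.1 hy.2) e
    refine (c1.union c2).mono_of_mem_nhdsWithin ?_
    have o1 : {y : ℝ × ℝ | 0 < y.2} ∈ nhds x :=
      (isOpen_lt continuous_const continuous_snd).mem_nhds (by simp [h2])
    filter_upwards [self_mem_nhdsWithin, mem_nhdsWithin_of_mem_nhds o1] with y hy h1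
    rcases lowerHalf_cases hy with h | h | h
    · exact Or.inl h
    · rw [h] at h1; simp at h1
    · exact Or.inr ⟨hy, h⟩

lemma psi_reflect {K : ℝ × ℝ → ℝ × ℝ} {δ : ℝ} {g : ℝ → ℝ → ℝ} {Ψ : ℝ × ℝ → ℝ × ℝ}
    (hΨ : IsPsi K δ g Ψ) {x : ℝ × ℝ} (hx : x ∈ upperHalf) :
    Ψ x = reflect (Ψ (reflect x)) := by
  rcases hx.2.1.eq_or_lt with he | hlt
  · rw [psi_line hΨ hx.1 he.symm, psi_line hΨ (x := reflect x) hx.1 (by simp only [reflect]; linarith)]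
    ext
    · simp [reflect, lineMap]
    · simp [reflect, lineMap]
  · exact hΨ.2.2.1 x ⟨hx.1, by linarith, hx.2.2⟩ hlt

lemma reflect_mapsTo : MapsTo reflect upperHalf lowerHalf := fun x hx =>
  ⟨hx.1, by have := hx.2.2; simp only [reflect]; linarith,
    by have := hx.2.1; simp only [reflect]; linarith⟩

lemma reflect_mapsTo' : MapsTo reflect lowerHalf upperHalf := fun x hx =>
  ⟨hx.1, by have := hx.2.2; simp only [reflect]; linarith,
    by have := hx.2.1; simp only [reflect]; linarith⟩

lemma unitSq_eq : unitSq = lowerHalf ∪ upperHalf := by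
  ext x
  simp only [unitSq, lowerHalf, upperHalf, mem_union, mem_prod, mem_Icc]
  constructor
  · rintro ⟨h1, h2, h3⟩
    rcases le_total x.2 (1/2) with h | h
    · exact Or.inl ⟨h1, h2, h⟩
    · exact Or.inr ⟨h1, h, h3⟩
  · rintro (⟨h1, h2, h3⟩ | ⟨h1, h2, h3⟩)
    · exact ⟨h1, h2, by linarith⟩
    · exact ⟨h1, by linarith, h3⟩

lemma psi_continuousOn {K : ℝ × ℝ → ℝ × ℝ} {δ : ℝ} {g : ℝ → ℝ → ℝ} {Ψ : ℝ × ℝ → ℝ × ℝ}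
    (hΨ : IsPsi K δ g Ψ) (hc : ContinuousOn Ψ lowerHalf) : ContinuousOn Ψ unitSq := by
  have hrc : Continuous reflect := by unfold reflect; fun_prop
  have h2 : ContinuousOn Ψ upperHalf :=
    (hrc.comp_continuousOn (hc.comp hrc.continuousOn reflect_mapsTo)).congr
      fun x hx => psi_reflect hΨ hx
  rw [unitSq_eq]
  exact hc.union_of_isClosed h2 (isClosed_Icc.prod isClosed_Icc) (isClosed_Icc.prod isClosed_Icc)

/-! ### Bijectivity -/

lemma psi_bijOn_lowerDom {h Θ : ℝ → ℝ} {K : ℝ × ℝ → ℝ × ℝ} (hK : GoodK h Θ K) {δ : ℝ}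
    {g : ℝ → ℝ → ℝ} (hg : IsGFamily h Θ δ g)
    {Ψ : ℝ × ℝ → ℝ × ℝ} (hΨ : IsPsi K δ g Ψ) : BijOn Ψ lowerDom lowerDom := by
  refine ⟨fun x hx => (hΨ.1 x hx).1, ?_, ?_⟩
  · intro x hx y hy hxy
    obtain ⟨-, a1, a2⟩ := hΨ.1 x hx
    obtain ⟨-, b1, b2⟩ := hΨ.1 y hy
    rw [hxy] at a1 a2
    have e1 : (K x).1 = (K y).1 := a1.symm.trans b1
    have e2 := a2.symm.trans b2
    rw [← e1] at e2
    have e3 := (hg _ (K_mem hK hx).1).2.1.injOn (K_mem hK hx).2 (K_mem hK hy).2 e2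
    exact hK.1.injOn hx hy (Prod.ext e1 e3)
  · intro y hy
    obtain ⟨hy1, hy2⟩ := K_mem hK hy
    obtain ⟨t, ht, hgt⟩ := (hg _ hy1).2.1.surjOn hy2
    obtain ⟨x, hx, hKx⟩ := hK.1.surjOn (show ((K y).1, t) ∈ _ from ⟨hy1, ht⟩)
    refine ⟨x, hx, ?_⟩
    obtain ⟨a0, a1, a2⟩ := hΨ.1 x hx
    rw [hKx] at a1 a2
    exact hK.1.injOn a0 hy (Prod.ext a1 (a2.trans hgt))

/-- The middle line. -/
def midLine : Set (ℝ × ℝ) := {x | x.1 ∈ Icc (0:ℝ) 1 ∧ x.2 = 1/2}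

lemma psi_bijOn_midLine {K : ℝ × ℝ → ℝ × ℝ} {δ : ℝ} (hδ : δ ∈ Ioo (-1:ℝ) 1)
    {g : ℝ → ℝ → ℝ} {Ψ : ℝ × ℝ → ℝ × ℝ} (hΨ : IsPsi K δ g Ψ) : BijOn Ψ midLine midLine := by
  obtain ⟨hδ1, hδ2⟩ := hδ
  refine ⟨?_, ?_, ?_⟩
  · intro x hx
    rw [psi_line hΨ hx.1 hx.2]
    obtain ⟨⟨h0, h1⟩, h2⟩ := hx
    refine ⟨⟨?_, ?_⟩, h2⟩ <;> simp only [lineMap] <;>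
      rcases abs_cases (x.1 - 1/2) with ⟨he, _⟩ | ⟨he, _⟩ <;> rw [he] <;> nlinarith
  · intro x hx y hy hxy
    rw [psi_line hΨ hx.1 hx.2, psi_line hΨ hy.1 hy.2] at hxy
    have h1 := congrArg Prod.fst hxy
    simp only [lineMap] at h1
    refine Prod.ext ?_ (hx.2.trans hy.2.symm)
    have h2 := abs_abs_sub_abs_le_abs_sub (x.1 - 1/2) (y.1 - 1/2)
    have h3 : x.1 - y.1 = δ * (|x.1 - 1/2| - |y.1 - 1/2|) := by linarith
    have h4 : |x.1 - y.1| ≤ |δ| * |x.1 - y.1| := by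
      calc |x.1 - y.1| = |δ| * |(|x.1 - 1/2| - |y.1 - 1/2|)| := by rw [← abs_mul, ← h3]
        _ ≤ |δ| * |(x.1 - 1/2) - (y.1 - 1/2)| := by gcongr
        _ = _ := by congr 2; ring
    have h5 : |δ| < 1 := abs_lt.2 ⟨hδ1, hδ2⟩
    have h6 : |x.1 - y.1| = 0 := by nlinarith [abs_nonneg (x.1 - y.1)]
    linarith [abs_eq_zero.1 h6]
  · rintro ⟨a, b⟩ ⟨⟨h0, h1⟩, h2⟩
    simp only at h0 h1 h2
    subst h2
    obtain ⟨-, -, -, k1, k2⟩ := hΨ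
    rcases le_total a ((1 + δ) / 2) with ha | ha
    · have hp : 0 < 1 + δ := by linarith
      have q0 : 0 ≤ a / (1 + δ) := by positivity
      have q1 : a / (1 + δ) ≤ 1/2 := by rw [div_le_iff₀ hp]; linarith
      refine ⟨(a / (1 + δ), 1/2), ⟨⟨q0, by simp only; linarith⟩, rfl⟩, ?_⟩
      rw [k1 _ q0 q1]
      congr 1; field_simp
    · have hp : 0 < 1 - δ := by linarith
      have q0 : 0 ≤ (a - (1 + δ) / 2) / (1 - δ) := div_nonneg (by linarith) hp.le
      have q1 : (a - (1 + δ) / 2) / (1 - δ) ≤ 1/2 := by rw [div_le_iff₀ hp]; linarith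
      refine ⟨(1/2 + (a - (1 + δ) / 2) / (1 - δ), 1/2),
        ⟨⟨by simp only; linarith, by simp only; linarith⟩, rfl⟩, ?_⟩
      rw [k2 _ (by linarith) (by linarith)]
      congr 1; field_simp; ring

/-- The lower half without the middle line. -/
def openLower : Set (ℝ × ℝ) := Icc (0:ℝ) 1 ×ˢ Ico (0:ℝ) (1/2)

/-- The upper half without the middle line. -/
def openUpper : Set (ℝ × ℝ) := Icc (0:ℝ) 1 ×ˢ Ioc (1/2:ℝ) 1

lemma openLower_eq : openLower = lowerDom ∪ {((1/2, 0) : ℝ × ℝ)} := by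
  unfold openLower lowerDom
  rw [sdiff_union_of_subset]
  rw [singleton_subset_iff]
  norm_num

lemma psi_bijOn {h Θ : ℝ → ℝ} {K : ℝ × ℝ → ℝ × ℝ} (hK : GoodK h Θ K) {δ : ℝ}
    (hδ : δ ∈ Ioo (-1:ℝ) 1) {g : ℝ → ℝ → ℝ} (hg : IsGFamily h Θ δ g)
    {Ψ : ℝ × ℝ → ℝ × ℝ} (hΨ : IsPsi K δ g Ψ) : BijOn Ψ unitSq unitSq := by
  have b1 := psi_bijOn_lowerDom hK hg hΨ
  have b2 := psi_bijOn_midLine hδ hΨ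
  have b3 : BijOn Ψ openLower openLower := by
    rw [openLower_eq]
    have hs : BijOn Ψ {((1/2, 0) : ℝ × ℝ)} {((1/2, 0) : ℝ × ℝ)} := by
      rw [bijOn_singleton]; exact hΨ.2.1
    refine b1.union hs ?_
    rw [injOn_union (disjoint_left.2 fun x hx hx' => hx.2 hx')]
    refine ⟨b1.injOn, hs.injOn, fun x hx y hy hxy => ?_⟩
    rw [mem_singleton_iff.1 hy, hΨ.2.1] at hxy
    exact (b1.mapsTo hx).2 hxy
  have rl : BijOn reflect openLower openUpper := by
    refine ⟨fun x hx => ?_, fun x _ y _ hxy => ?_, fun x hx => ⟨reflect x, ?_, reflect_reflect x⟩⟩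
    · obtain ⟨h1, h2, h3⟩ := hx
      exact ⟨h1, by simp only [reflect]; linarith, by simp only [reflect]; linarith⟩
    · rw [← reflect_reflect x, hxy, reflect_reflect]
    · obtain ⟨h1, h2, h3⟩ := hx
      exact ⟨h1, by simp only [reflect]; linarith, by simp only [reflect]; linarith⟩
  have ru : BijOn reflect openUpper openLower := by
    refine ⟨fun x hx => ?_, fun x _ y _ hxy => ?_, fun x hx => ⟨reflect x, rl.mapsTo hx, reflect_reflect x⟩⟩
    · obtain ⟨h1, h2, h3⟩ := hx
      exact ⟨h1, by simp only [reflect]; linarith, by simp only [reflect]; linarith⟩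
    · rw [← reflect_reflect x, hxy, reflect_reflect]
  have b4 : BijOn Ψ openUpper openUpper := by
    refine (rl.comp (b3.comp ru)).congr fun x hx => ?_
    exact (psi_reflect hΨ ⟨hx.1, hx.2.1.le, hx.2.2⟩).symm
  have d1 : Disjoint openLower midLine :=
    disjoint_left.2 fun x hx hx' => (hx.2.2).ne hx'.2
  have b5 : BijOn Ψ (openLower ∪ midLine) (openLower ∪ midLine) := by
    refine b3.union b2 ?_
    rw [injOn_union d1]
    exact ⟨b3.injOn, b2.injOn, fun x hx y hy hxy =>
      disjoint_left.1 d1 (b3.mapsTo hx) (hxy ▸ b2.mapsTo hy)⟩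
  have d2 : Disjoint (openLower ∪ midLine) openUpper := by
    refine disjoint_left.2 fun x hx hx' => ?_
    have := hx'.2.1
    rcases hx with hx | hx
    · have := hx.2.2
      linarith
    · have := hx.2
      linarith
  have b6 : BijOn Ψ ((openLower ∪ midLine) ∪ openUpper) ((openLower ∪ midLine) ∪ openUpper) := by
    refine b5.union b4 ?_
    rw [injOn_union d2]
    exact ⟨b5.injOn, b4.injOn, fun x hx y hy hxy =>
      disjoint_left.1 d2 (b5.mapsTo hx) (hxy ▸ b4.mapsTo hy)⟩
  have e : unitSq = (openLower ∪ midLine) ∪ openUpper := by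
    ext x
    simp only [unitSq, openLower, midLine, openUpper, mem_union, mem_prod, mem_Icc, mem_Ico,
      mem_Ioc, mem_ofPred_eq]
    constructor
    · rintro ⟨h1, h2, h3⟩
      rcases lt_trichotomy x.2 (1/2) with h | h | h
      · exact Or.inl (Or.inl ⟨h1, h2, h⟩)
      · exact Or.inl (Or.inr ⟨h1, h⟩)
      · exact Or.inr ⟨h1, h, h3⟩
    · rintro ((⟨h1, h2, h3⟩ | ⟨h1, h2⟩) | ⟨h1, h2, h3⟩)
      · exact ⟨h1, h2, by linarith⟩
      · exact ⟨h1, by linarith, by linarith⟩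
      · exact ⟨h1, by linarith, h3⟩
  rw [e]; exact b6

/-! ### The boundary is fixed -/

lemma psi_bdry_lower {h : ℝ → ℝ} (hh : GoodH h)
    {r₀ : ℝ} (hr₀ : r₀ ∈ Ioo (0:ℝ) (1/2)) (hr₀eq : 2 * r₀ * h r₀ + r₀ ^ 2 = 1/4)
    {Θ : ℝ → ℝ} (hΘ : GoodTheta h r₀ Θ) {K : ℝ × ℝ → ℝ × ℝ}
    (hK : GoodK h Θ K) {δ : ℝ}
    {g : ℝ → ℝ → ℝ} (hg : IsGFamily h Θ δ g)
    {Ψ : ℝ × ℝ → ℝ × ℝ} (hΨ : IsPsi K δ g Ψ) {x : ℝ × ℝ} (hx : x ∈ lowerHalf)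
    (hb : x.1 = 0 ∨ x.1 = 1 ∨ x.2 = 0) : Ψ x = x := by
  rcases lowerHalf_cases hx with hd | rfl | h2
  · obtain ⟨hr, hθ⟩ := K_mem hK hd
    obtain ⟨k1, k2⟩ := hK.2 x hd
    have hpm := theta_pm_one (ptData hh hr₀ hr₀eq hΘ hr) hθ (by
      rcases hb with hb | hb | hb
      · left
        rw [show ((K x).1 + h (K x).1) * Real.sin ((K x).2 * Θ (K x).1) = -(1/2) by linarith]
        norm_num
      · left
        rw [show ((K x).1 + h (K x).1) * Real.sin ((K x).2 * Θ (K x).1) = 1/2 by linarith]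
        norm_num
      · right; linarith)
    obtain ⟨a0, a1, a2⟩ := hΨ.1 x hd
    obtain ⟨-, -, g1, g2, -, -⟩ := hg _ hr
    refine hK.1.injOn a0 hd (Prod.ext a1 (a2.trans ?_))
    rcases hpm with e | e
    · rw [e, g1]
    · rw [e, g2]
  · exact hΨ.2.1
  · rw [psi_line hΨ hx.1 h2]
    refine Prod.ext ?_ rfl
    simp only [lineMap]
    rcases hb with hb | hb | hb
    · rw [hb]; norm_num
    · rw [hb]; norm_num
    · rw [hb] at h2; norm_num at h2

lemma psi_bdry {h : ℝ → ℝ} (hh : GoodH h)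
    {r₀ : ℝ} (hr₀ : r₀ ∈ Ioo (0:ℝ) (1/2)) (hr₀eq : 2 * r₀ * h r₀ + r₀ ^ 2 = 1/4)
    {Θ : ℝ → ℝ} (hΘ : GoodTheta h r₀ Θ) {K : ℝ × ℝ → ℝ × ℝ}
    (hK : GoodK h Θ K) {δ : ℝ}
    {g : ℝ → ℝ → ℝ} (hg : IsGFamily h Θ δ g)
    {Ψ : ℝ × ℝ → ℝ × ℝ} (hΨ : IsPsi K δ g Ψ) {x : ℝ × ℝ} (hx : x ∈ unitSqBdry) : Ψ x = x := by
  obtain ⟨hs, hb⟩ := hx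
  rw [unitSq_eq] at hs
  rcases hs with hl | hu
  · refine psi_bdry_lower hh hr₀ hr₀eq hΘ hK hg hΨ hl ?_
    rcases hb with hb | hb | hb | hb
    · exact Or.inl hb
    · exact Or.inr (Or.inl hb)
    · exact Or.inr (Or.inr hb)
    · have := hl.2.2; rw [hb] at this; norm_num at this
  · rw [psi_reflect hΨ hu, psi_bdry_lower hh hr₀ hr₀eq hΘ hK hg hΨ (reflect_mapsTo hu),
      reflect_reflect]
    rcases hb with hb | hb | hb | hb
    · exact Or.inl hb
    · exact Or.inr (Or.inl hb)
    · have := hu.2.1; rw [hb] at this; norm_num at this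
    · right; right; simp [reflect, hb]

theorem stmt_2 (h : ℝ → ℝ) (hh : GoodH h)
    (r₀ : ℝ) (hr₀ : r₀ ∈ Set.Ioo (0:ℝ) (1/2)) (hr₀eq : 2 * r₀ * h r₀ + r₀ ^ 2 = 1/4)
    (Θ : ℝ → ℝ) (hΘ : GoodTheta h r₀ Θ)
    (K : ℝ × ℝ → ℝ × ℝ) (hK : GoodK h Θ K)
    (δ : ℝ) (hδ : δ ∈ Set.Ioo (-1:ℝ) 1)
    (g : ℝ → ℝ → ℝ) (hg : IsGFamily h Θ δ g)
    (Ψ : ℝ × ℝ → ℝ × ℝ) (hΨ : IsPsi K δ g Ψ) :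
    ContinuousOn Ψ unitSq ∧ Set.BijOn Ψ unitSq unitSq ∧ ∀ x ∈ unitSqBdry, Ψ x = x := by
  exact ⟨psi_continuousOn hΨ (psi_continuousOn_lowerHalf hh hr₀ hr₀eq hΘ hK hδ hg hΨ),
    psi_bijOn hK hδ hg hΨ, fun x hx => psi_bdry hh hr₀ hr₀eq hΘ hK hg hΨ hx⟩
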